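/- arXiv:math/0211200 — 2 statements merged into one kernel-verified Lean document; each statement's English description precedes it below -/
import Mathlib

section
/- For every positive integer n, the map σ ↦ M_σ is an injective group homomorphism from the symmetric group S_n into the group of invertible n×n integer matrices: M_τ · M_σ = M_{τσ} for all σ, τ ∈ S_n (where τσ denotes the composition applying σ first and then τ), and M_σ = M_τ implies σ = τ. -/
/-- `eVec n m` is the standard basis column vector `e_m` of `ℤ^n` (1-based index `m`,
with `e_{n+1} = 0`; indeed `eVec n m = 0` whenever `m = 0` or `m > n`). -/
def eVec (n : ℕ) (m : ℕ) : Fin n → ℤ := fun i => if (i : ℕ) + 1 = m then 1 else 0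

/-- `deltaVec n m` is `δ_m = e_{m+1} - e_m` (1-based index `m`). -/
def deltaVec (n : ℕ) (m : ℕ) : Fin n → ℤ := eVec n (m + 1) - eVec n m

/-- `Dset σ` is the set `D(σ) = {1} ∪ {k : σ⁻¹(k−1) > σ⁻¹(k)}` of the paper, encoded
0-based: the element `i : Fin n` represents `k = i + 1` of `{1, …, n}`. -/
def Dset {n : ℕ} (σ : Equiv.Perm (Fin n)) : Finset (Fin n) :=
  Finset.univ.filter fun i => (i : ℕ) = 0 ∨ σ⁻¹ i < σ⁻¹ ⟨(i : ℕ) - 1, lt_of_le_of_lt (Nat.sub_le _ _) i.isLt⟩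

/-- `wVec σ j` is the vector `w^σ_{j+1}` of the paper (so `wVec σ 0 = w^σ_1` is the sum of
the `e_i` over `i ∈ D(σ)`, and `wVec σ j = wVec σ (j-1) + δ_{σ(j)}` for `1 ≤ j ≤ n`,
where the permutation of `{1, …, n}` is encoded 0-based as `σ : Equiv.Perm (Fin n)`). -/
def wVec {n : ℕ} (σ : Equiv.Perm (Fin n)) : ℕ → (Fin n → ℤ)
  | 0 => ∑ i ∈ Dset σ, eVec n ((i : ℕ) + 1)
  | j + 1 => wVec σ j + (if h : j < n then deltaVec n ((σ ⟨j, h⟩ : ℕ) + 1) else 0)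

/-- `Lmat σ` is the `n × (n+1)` matrix `L_σ` whose columns are `w^σ_1, …, w^σ_{n+1}`. -/
def Lmat {n : ℕ} (σ : Equiv.Perm (Fin n)) : Matrix (Fin n) (Fin (n + 1)) ℤ :=
  Matrix.of fun i j => wVec σ (j : ℕ) i

/-- `Mmat σ` is the `n × n` matrix `M_σ` whose `j`-th column is `w^σ_j - w^σ_{n+1}`. -/
def Mmat {n : ℕ} (σ : Equiv.Perm (Fin n)) : Matrix (Fin n) (Fin n) ℤ :=
  Matrix.of fun i j => wVec σ (j : ℕ) i - wVec σ n i

/-- `Pmat σ` is the permutation matrix `P_σ = (p_{ij})`, `p_{ij} = ⟦j = σ(i)⟧`. -/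
def Pmat {n : ℕ} (R : Type*) [Zero R] [One R] (σ : Equiv.Perm (Fin n)) :
    Matrix (Fin n) (Fin n) R :=
  Matrix.of fun i j => if j = σ i then 1 else 0

/-- The coordinates of `wVec σ m` as partial sums of the vectors `δ_{σ(k)}`. -/
theorem wVec_apply {n : ℕ} (σ : Equiv.Perm (Fin n)) (m : ℕ) (i : Fin n) :
    wVec σ m i =
      wVec σ 0 i + ∑ k : Fin n, if (k : ℕ) < m then deltaVec n ((σ k : ℕ) + 1) i else 0 := by
  induction m with
  | zero => simp
  | succ m ih =>
    rw [show wVec σ (m + 1) i = wVec σ m i +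
      (if h : m < n then deltaVec n ((σ ⟨m, h⟩ : ℕ) + 1) else 0) i from rfl, ih, add_assoc]
    congr 1
    by_cases h : m < n
    · have key : ∀ k : Fin n, (if (k : ℕ) < m + 1 then deltaVec n ((σ k : ℕ) + 1) i else 0) =
          (if (k : ℕ) < m then deltaVec n ((σ k : ℕ) + 1) i else 0) +
            if k = ⟨m, h⟩ then deltaVec n ((σ k : ℕ) + 1) i else 0 := by
        intro k
        simp only [Fin.ext_iff]
        split_ifs <;> omega
      simp only [key, Finset.sum_add_distrib]
      simp [h]
    · rw [dif_neg h, Pi.zero_apply, add_zero]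
      refine Finset.sum_congr rfl fun k _ => ?_
      have := k.isLt
      rw [if_pos (by omega), if_pos (by omega)]

/-- The matrix whose columns are `δ_1, …, δ_n`. -/
def deltaMat (n : ℕ) : Matrix (Fin n) (Fin n) ℤ :=
  Matrix.of fun i k => deltaVec n ((k : ℕ) + 1) i

/-- The lower triangular matrix with all entries `-1` on and below the diagonal. -/
def negLowerMat (n : ℕ) : Matrix (Fin n) (Fin n) ℤ :=
  Matrix.of fun k j => if j ≤ k then -1 else 0

theorem deltaMat_mul_negLowerMat (n : ℕ) : deltaMat n * negLowerMat n = 1 := by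
  ext i j
  let g : ℕ → ℤ := fun k => if (i : ℕ) = max k j then 1 else 0
  have key : ∀ k : Fin n, deltaMat n i k * negLowerMat n k j = -(g (k + 1) - g k) := by
    intro k
    simp only [deltaMat, negLowerMat, deltaVec, eVec, Matrix.of_apply, Pi.sub_apply, g,
      Fin.le_def]
    split_ifs <;> omega
  rw [Matrix.mul_apply, Finset.sum_congr rfl fun k _ => key k, Finset.sum_neg_distrib,
    Fin.sum_univ_eq_sum_range (fun k => g (k + 1) - g k), Finset.sum_range_sub,
    Matrix.one_apply]
  have := i.isLt
  simp only [g, Fin.ext_iff]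
  split_ifs <;> omega

theorem negLowerMat_mul_deltaMat (n : ℕ) : negLowerMat n * deltaMat n = 1 :=
  mul_eq_one_comm.mp (deltaMat_mul_negLowerMat n)

/-- `M_σ` is conjugate to a permutation matrix, by a matrix independent of `σ`. -/
theorem Mmat_eq_conj {n : ℕ} (σ : Equiv.Perm (Fin n)) :
    Mmat σ = deltaMat n * (σ⁻¹).permMatrix ℤ * negLowerMat n := by
  ext i j
  have hcol : ∀ k, (deltaMat n * (σ⁻¹).permMatrix ℤ) i k = deltaMat n i (σ k) := by
    intro k
    simp [Matrix.mul_apply, Equiv.Perm.permMatrix, PEquiv.toMatrix_apply, Equiv.symm_apply_eq]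
  rw [Matrix.mul_apply, Mmat, Matrix.of_apply, wVec_apply σ j, wVec_apply σ n,
    add_sub_add_left_eq_sub, ← Finset.sum_sub_distrib]
  refine Finset.sum_congr rfl fun k _ => ?_
  have := k.isLt
  rw [hcol]
  simp only [deltaMat, negLowerMat, Matrix.of_apply, Fin.le_def]
  split_ifs <;> omega

/-- The map `σ ↦ M_σ` is an injective group homomorphism from `S_n` into the invertible
`n × n` integer matrices: `M_τ · M_σ = M_{τσ}` (where `τ * σ` applies `σ` first), and
`M_σ = M_τ` implies `σ = τ`. -/
theorem Mmat_hom_injective (n : ℕ) :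
    (∀ σ τ : Equiv.Perm (Fin n), Mmat τ * Mmat σ = Mmat (τ * σ)) ∧
      Function.Injective (Mmat (n := n)) := by
  have hBA := negLowerMat_mul_deltaMat n
  refine ⟨fun σ τ => ?_, fun σ τ h => ?_⟩
  · rw [Mmat_eq_conj, Mmat_eq_conj, Mmat_eq_conj, mul_inv_rev, Matrix.permMatrix_mul]
    simp only [Matrix.mul_assoc]
    rw [← Matrix.mul_assoc (negLowerMat n), hBA, Matrix.one_mul]
  · have hconj : ∀ ρ : Equiv.Perm (Fin n),
        negLowerMat n * Mmat ρ * deltaMat n = (ρ⁻¹).permMatrix ℤ := by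
      intro ρ
      rw [Mmat_eq_conj, Matrix.mul_assoc, Matrix.mul_assoc, hBA, Matrix.mul_one,
        ← Matrix.mul_assoc, hBA, Matrix.one_mul]
    have hperm : (σ⁻¹).permMatrix ℤ = (τ⁻¹).permMatrix ℤ := by rw [← hconj, ← hconj, h]
    exact inv_injective (Equiv.ext fun i => by
      have := PEquiv.toMatrix_injective hperm
      simpa using DFunLike.congr_fun this i)
end

section
/- For every permutation σ of {1, …, n}: every entry of the matrix L_σ lies in {0, 1}, and every entry of the matrix M_σ lies in {−1, 0, 1}. -/
/-- Coordinate `i` of `wVec σ j`: it starts at `1` or `0` according to `i ∈ Dset σ`, gains `1` once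
the value `i - 1` has been read off `σ`, and loses `1` once the value `i` has been read off. -/
theorem wVec_apply_s8 {n : ℕ} (σ : Equiv.Perm (Fin n)) (j : ℕ) (i : Fin n) :
    wVec σ j i = (if i ∈ Dset σ then 1 else 0)
      + (if (i : ℕ) ≠ 0 ∧
          (σ⁻¹ ⟨(i : ℕ) - 1, lt_of_le_of_lt (Nat.sub_le _ _) i.isLt⟩ : ℕ) < j then 1 else 0)
      - (if (σ⁻¹ i : ℕ) < j then 1 else 0) := by
  induction j with
  | zero => simp [wVec, eVec, Finset.sum_apply, Fin.val_inj]
  | succ j ih =>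
    rw [wVec, Pi.add_apply, ih]
    set k : Fin n := ⟨(i : ℕ) - 1, lt_of_le_of_lt (Nat.sub_le _ _) i.isLt⟩
    have hkv : (k : ℕ) = (i : ℕ) - 1 := rfl
    by_cases h : j < n
    · have key (l : Fin n) : (σ ⟨j, h⟩ : ℕ) = l ↔ (σ⁻¹ l : ℕ) = j := by
        rw [Fin.val_inj, ← Equiv.Perm.eq_inv_iff_eq, Fin.ext_iff, eq_comm]
      have hi := key i
      have hk' := key k
      simp only [dif_pos h, deltaVec, eVec, Pi.sub_apply]
      split_ifs <;> omega
    · have := (σ⁻¹ i).isLt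
      have := (σ⁻¹ k).isLt
      simp only [dif_neg h, Pi.zero_apply]
      split_ifs <;> omega

theorem wVec_apply_eq_zero_or_one {n : ℕ} (σ : Equiv.Perm (Fin n)) (j : ℕ) (i : Fin n) :
    wVec σ j i = 0 ∨ wVec σ j i = 1 := by
  rw [wVec_apply_s8]
  have hD : i ∈ Dset σ ↔ (i : ℕ) = 0 ∨
      (σ⁻¹ i : ℕ) < σ⁻¹ ⟨(i : ℕ) - 1, lt_of_le_of_lt (Nat.sub_le _ _) i.isLt⟩ := by
    simp [Dset]
  have hne : (i : ℕ) ≠ 0 →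
      (σ⁻¹ i : ℕ) ≠ σ⁻¹ ⟨(i : ℕ) - 1, lt_of_le_of_lt (Nat.sub_le _ _) i.isLt⟩ := by
    intro h0 h
    have := congrArg Fin.val (σ⁻¹.injective (Fin.ext h))
    simp only at this
    omega
  simp only [hD]
  split_ifs <;> omega

/-- Every entry of `L_σ` lies in `{0, 1}`, and every entry of `M_σ` lies in `{-1, 0, 1}`. -/
theorem Lmat_Mmat_entries (n : ℕ) (σ : Equiv.Perm (Fin n)) :
    (∀ (i : Fin n) (j : Fin (n + 1)), Lmat σ i j = 0 ∨ Lmat σ i j = 1) ∧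
      (∀ i j : Fin n, Mmat σ i j = -1 ∨ Mmat σ i j = 0 ∨ Mmat σ i j = 1) := by
  refine ⟨fun i j => wVec_apply_eq_zero_or_one σ j i, fun i j => ?_⟩
  have hj := wVec_apply_eq_zero_or_one σ j i
  have hn := wVec_apply_eq_zero_or_one σ n i
  simp only [Mmat, Matrix.of_apply]
  omega
end
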